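/- Let Λ and Λ' be discrete subgroups of ℝⁿ such that Λ + Λ' is discrete. Then |Λ + Λ'| ≤ |Λ|·|Λ'| / |Λ ∩ Λ'|. -/

import Mathlib

open scoped BigOperators
open Matrix Topology Filter

noncomputable section

namespace SW

/-! ### Euclidean structure on `Fin n → ℝ` -/

/-- The standard Euclidean inner product on `Fin n → ℝ`. -/
def einner {n : ℕ} (v w : Fin n → ℝ) : ℝ := ∑ i, v i * w i

/-- The Euclidean norm on `Fin n → ℝ`. -/
def enorm {n : ℕ} (v : Fin n → ℝ) : ℝ := Real.sqrt (∑ i, v i ^ 2)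

lemma einner_add_left {n : ℕ} (u v w : Fin n → ℝ) :
    einner (u + v) w = einner u w + einner v w := by
  simp [einner, add_mul, Finset.sum_add_distrib]

lemma einner_neg_left {n : ℕ} (u w : Fin n → ℝ) : einner (-u) w = -einner u w := by
  simp [einner]

lemma einner_smul_left {n : ℕ} (c : ℝ) (u w : Fin n → ℝ) :
    einner (c • u) w = c * einner u w := by
  simp [einner, Finset.mul_sum, mul_assoc]

/-! ### Covolume, rank, lattices, stability -/

/-- `√(det Gram)` of a finite family of vectors: the covolume of the ℤ-span of the family
(in the span of the family) when the family is linearly independent. -/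
def gvol {n r : ℕ} (v : Fin r → (Fin n → ℝ)) : ℝ :=
  Real.sqrt (Matrix.det (Matrix.of fun i j => einner (v i) (v j)))

/-- `c` is the covolume of `Λ` in its real span, as computed from some ℤ-basis of `Λ` which is
linearly independent over `ℝ`. -/
def covolSpec {n : ℕ} (Λ : AddSubgroup (Fin n → ℝ)) (c : ℝ) : Prop :=
  ∃ (r : ℕ) (v : Fin r → (Fin n → ℝ)), LinearIndependent ℝ v ∧
    Λ = AddSubgroup.closure (Set.range v) ∧ c = gvol v

/-- The covolume of a discrete subgroup `Λ ⊆ ℝⁿ` inside its real span (with `covol ⊥ = 1`). -/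
def covol {n : ℕ} (Λ : AddSubgroup (Fin n → ℝ)) : ℝ := sInf {c | covolSpec Λ c}

/-- The rank of a discrete subgroup of `ℝⁿ`: the dimension of its real span. -/
def rk {n : ℕ} (Λ : AddSubgroup (Fin n → ℝ)) : ℕ :=
  Module.finrank ℝ (Submodule.span ℝ (Λ : Set (Fin n → ℝ)))

/-- A lattice in `ℝⁿ`: a discrete subgroup spanning `ℝⁿ` (equivalently, cocompact). -/
def IsLattice {n : ℕ} (L : AddSubgroup (Fin n → ℝ)) : Prop :=
  DiscreteTopology ↥L ∧ Submodule.span ℝ (L : Set (Fin n → ℝ)) = ⊤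

/-- A unimodular lattice: a lattice of covolume one. -/
def IsUnimodularLattice {n : ℕ} (L : AddSubgroup (Fin n → ℝ)) : Prop :=
  IsLattice L ∧ covol L = 1

/-- A stable lattice: a unimodular lattice all of whose subgroups have covolume at least one. -/
def IsStable {n : ℕ} (L : AddSubgroup (Fin n → ℝ)) : Prop :=
  IsUnimodularLattice L ∧ ∀ Λ : AddSubgroup (Fin n → ℝ), Λ ≤ L → 1 ≤ covol Λ

/-! ### Matrices: the diagonal group `A`, `SL_n(ℤ)`, lattices from matrices -/

/-- The group `A` of positive diagonal matrices of determinant one (as a set of matrices). -/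
def Apos (n : ℕ) : Set (Matrix (Fin n) (Fin n) ℝ) :=
  {a | ∃ d : Fin n → ℝ, (∀ i, 0 < d i) ∧ (∏ i, d i) = 1 ∧ a = Matrix.diagonal d}

/-- `SL_n(ℤ)` viewed as a set of real matrices. -/
def Gam (n : ℕ) : Set (Matrix (Fin n) (Fin n) ℝ) :=
  {γ | γ.det = 1 ∧ ∀ i j, ∃ m : ℤ, γ i j = (m : ℝ)}

/-- The lattice `g·ℤⁿ` associated to a matrix `g`. -/
def latticeOf {n : ℕ} (g : Matrix (Fin n) (Fin n) ℝ) : AddSubgroup (Fin n → ℝ) :=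
  AddSubgroup.closure (Set.range fun m : Fin n → ℤ => g.mulVec fun i => (m i : ℝ))

/-- The image `g·L` of a lattice under a matrix. -/
def mapLat {n : ℕ} (g : Matrix (Fin n) (Fin n) ℝ) (L : AddSubgroup (Fin n → ℝ)) :
    AddSubgroup (Fin n → ℝ) :=
  AddSubgroup.map (Matrix.mulVecLin g).toAddMonoidHom L

/-- The full preimage `A·g·Γ` in `SL_n(ℝ)` of the orbit `A·[g] ⊆ ℒ_n`; a point `[h] ∈ ℒ_n`
lies in the closure of `A·[g]` iff `h ∈ closure (AOrbit g)`. -/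
def AOrbit {n : ℕ} (g : Matrix (Fin n) (Fin n) ℝ) : Set (Matrix (Fin n) (Fin n) ℝ) :=
  {p | ∃ a ∈ Apos n, ∃ γ ∈ Gam n, p = a * g * γ}

/-- The orbit `A·[g] ⊆ ℒ_n` is bounded (has compact closure). -/
def HasBoundedAOrbit {n : ℕ} (g : Matrix (Fin n) (Fin n) ℝ) : Prop :=
  ∃ K : Set (Matrix (Fin n) (Fin n) ℝ), IsCompact K ∧
    ∀ a ∈ Apos n, ∃ γ ∈ Gam n, a * g * γ ∈ K

/-! ### `α`, `Min_δ`, `V_δ`, `dim_δ` -/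

/-- `α(x) = min { |Λ|^{1/r(Λ)} : Λ a nonzero subgroup of x }`. -/
def alpha {n : ℕ} (x : AddSubgroup (Fin n → ℝ)) : ℝ :=
  sInf {c | ∃ Λ : AddSubgroup (Fin n → ℝ), Λ ≤ x ∧ Λ ≠ ⊥ ∧ c = covol Λ ^ ((rk Λ : ℝ)⁻¹)}

/-- `α_k(x) = min { |Λ|^{1/k} : Λ a rank-`k` subgroup of x }`. -/
def alphak {n : ℕ} (k : ℕ) (x : AddSubgroup (Fin n → ℝ)) : ℝ :=
  sInf {c | ∃ Λ : AddSubgroup (Fin n → ℝ), Λ ≤ x ∧ rk Λ = k ∧ c = covol Λ ^ ((k : ℝ)⁻¹)}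

/-- `Min_δ(x)`: nonzero subgroups nearly attaining `α(x)`. -/
def MinSet {n : ℕ} (δ : ℝ) (x : AddSubgroup (Fin n → ℝ)) : Set (AddSubgroup (Fin n → ℝ)) :=
  {Λ | Λ ≤ x ∧ Λ ≠ ⊥ ∧ covol Λ ^ ((rk Λ : ℝ)⁻¹) < (1 + δ) * alpha x}

/-- `V_δ(x)`: the span of the subgroups in `Min_δ(x)`. -/
def Vdelta {n : ℕ} (δ : ℝ) (x : AddSubgroup (Fin n → ℝ)) : Submodule ℝ (Fin n → ℝ) :=
  Submodule.span ℝ (⋃ Λ ∈ MinSet δ x, (Λ : Set (Fin n → ℝ)))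

/-- `dim_δ(x) = dim V_δ(x)`. -/
def dimdelta {n : ℕ} (δ : ℝ) (x : AddSubgroup (Fin n → ℝ)) : ℕ :=
  Module.finrank ℝ (Vdelta δ x)

/-- `U_k^{x,ε} ⊆ A`: those `a` for which `δ ↦ dim_δ(ax)` equals `k` near `kε`. -/
def Uset {n : ℕ} (x : AddSubgroup (Fin n → ℝ)) (ε : ℝ) (k : ℕ) :
    Set (Matrix (Fin n) (Fin n) ℝ) :=
  {a | a ∈ Apos n ∧ ∃ s ∈ 𝓝 ((k : ℝ) * ε), ∀ δ ∈ s, dimdelta δ (mapLat a x) = k}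

/-- Logarithmic coordinates on the diagonal group. -/
def logCoord {n : ℕ} (a : Matrix (Fin n) (Fin n) ℝ) : Fin n → ℝ := fun i => Real.log (a i i)

/-! ### Covering radius -/

/-- The covering radius `covrad(L) = sup_u inf_{v ∈ L} ‖u - v‖`. -/
def covrad {n : ℕ} (L : AddSubgroup (Fin n → ℝ)) : ℝ :=
  ⨆ u : Fin n → ℝ, ⨅ v : L, enorm (u - (v : Fin n → ℝ))

/-- `[g]` is a local maximum of `covrad : ℒ_d → ℝ` (phrased via the open quotient
`SL_d(ℝ) → ℒ_d`). -/
def IsLocalMaxCovrad {d : ℕ} (g : Matrix (Fin d) (Fin d) ℝ) : Prop :=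
  ∃ W ∈ 𝓝 g, ∀ g' ∈ W, Matrix.det g' = 1 → covrad (latticeOf g') ≤ covrad (latticeOf g)

/-! ### Block upper triangular form -/

/-- Offset of the `i`-th diagonal block. -/
def off {k : ℕ} (ns : Fin k → ℕ) (i : Fin k) : ℕ :=
  ∑ j ∈ Finset.univ.filter (fun j => j < i), ns j

lemma off_add_lt {k : ℕ} (ns : Fin k → ℕ) (i : Fin k) (a : Fin (ns i)) :
    off ns i + (a : ℕ) < ∑ j, ns j := by
  unfold off
  have hins : i ∉ Finset.univ.filter (fun j => j < i) := by simp
  have h2 : ∑ j ∈ insert i (Finset.univ.filter (fun j => j < i)), ns j ≤ ∑ j, ns j :=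
    Finset.sum_le_sum_of_subset (Finset.subset_univ _)
  rw [Finset.sum_insert hins] at h2
  have := a.isLt
  omega

/-- The position, in `Fin n`, of the `a`-th coordinate of the `i`-th block. -/
def blockEmb {n k : ℕ} (ns : Fin k → ℕ) (hsum : (∑ j, ns j) = n) (i : Fin k)
    (a : Fin (ns i)) : Fin n :=
  ⟨off ns i + (a : ℕ), hsum ▸ off_add_lt ns i a⟩

/-- `g` is block upper triangular with diagonal blocks `G i` (block sizes `ns`). -/
def IsBlockUT {n k : ℕ} (ns : Fin k → ℕ) (hsum : (∑ j, ns j) = n)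
    (g : Matrix (Fin n) (Fin n) ℝ) (G : ∀ i, Matrix (Fin (ns i)) (Fin (ns i)) ℝ) : Prop :=
  (∀ (i : Fin k) (a b : Fin (ns i)),
      g (blockEmb ns hsum i a) (blockEmb ns hsum i b) = G i a b) ∧
  (∀ (i j : Fin k) (a : Fin (ns i)) (b : Fin (ns j)), j < i →
      g (blockEmb ns hsum i a) (blockEmb ns hsum j b) = 0)

/-! ### Mordell constant -/

/-- The symmetric box `[-a₁,a₁] × ⋯ × [-aₙ,aₙ]` is admissible for `L`: its interior contains
no nonzero point of `L`. -/
def IsAdmissibleBox {n : ℕ} (L : AddSubgroup (Fin n → ℝ)) (a : Fin n → ℝ) : Prop :=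
  (∀ i, 0 < a i) ∧ ∀ v ∈ L, v ≠ 0 → ∃ i, a i ≤ |v i|

/-- The Mordell constant `κ(L) = 2⁻ⁿ sup { Vol(B) : B admissible symmetric box for L }`. -/
def mordellConst {n : ℕ} (L : AddSubgroup (Fin n → ℝ)) : ℝ :=
  (1 / 2 ^ n) * sSup {V | ∃ a : Fin n → ℝ, IsAdmissibleBox L a ∧ V = ∏ i, 2 * a i}

/-! ### Hermite constant -/

/-- Length of a shortest nonzero vector of `L`. -/
def shortest {m : ℕ} (L : AddSubgroup (Fin m → ℝ)) : ℝ :=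
  sInf {t | ∃ w ∈ L, w ≠ 0 ∧ t = enorm w}

/-- The Hermite constant `γ_m`. -/
def hermiteConst (m : ℕ) : ℝ :=
  sSup {c | ∃ L : AddSubgroup (Fin m → ℝ), IsUnimodularLattice L ∧ c = shortest L ^ 2}

/-! ### Korkine–Zolotarev reduction -/

/-- `v 0, …, v (n-1)` is a Korkine–Zolotarev reduced basis of `x`: it is a ℤ-basis, and for
each `i` the orthogonal projection of `v i` onto `span(v 0, …, v (i-1))^⊥` is shortest among the
nonzero such projections of vectors of `x` (projection lengths are expressed through Gram
determinants: the projection of `w` has length `gvol (v 0, …, v (i-1), w) / gvol (v 0, …, v (i-1))`). -/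
def IsKZBasis {n : ℕ} (x : AddSubgroup (Fin n → ℝ)) (v : ℕ → (Fin n → ℝ)) : Prop :=
  LinearIndependent ℝ (fun j : Fin n => v (j : ℕ)) ∧
  x = AddSubgroup.closure (v '' Set.Iio n) ∧
  ∀ i < n, ∀ w ∈ x, w ∉ Submodule.span ℝ (v '' Set.Iio i) →
    gvol (Fin.snoc (fun j : Fin i => v (j : ℕ)) (v i)) ≤
      gvol (Fin.snoc (fun j : Fin i => v (j : ℕ)) w)

/-- `A 0, …, A (n-1)` are the diagonal Korkine–Zolotarev coefficients of `x`: the lengths of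
the successive orthogonal projections in a KZ reduced basis, i.e.
`A i = gvol (v 0, …, v i) / gvol (v 0, …, v (i-1))`. -/
def HasKZCoeffs {n : ℕ} (x : AddSubgroup (Fin n → ℝ)) (A : ℕ → ℝ) : Prop :=
  ∃ v : ℕ → (Fin n → ℝ), IsKZBasis x v ∧
    ∀ i < n, A i * gvol (fun j : Fin i => v (j : ℕ)) = gvol (fun j : Fin (i + 1) => v (j : ℕ))

/-! ### Orthogonal complements and projections of lattices -/

/-- The orthogonal complement of a subspace `V ⊆ ℝⁿ`. -/
def orthoC {n : ℕ} (V : Submodule ℝ (Fin n → ℝ)) : Submodule ℝ (Fin n → ℝ) where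
  carrier := {w | ∀ v ∈ V, einner w v = 0}
  zero_mem' := by intro v hv; simp [einner]
  add_mem' := by intro a b ha hb v hv; rw [einner_add_left, ha v hv, hb v hv, add_zero]
  smul_mem' := by intro c w hw v hv; rw [einner_smul_left, hw v hv, mul_zero]

/-- The image `π(x)` of `x` under the orthogonal projection `π : ℝⁿ → V^⊥`:
`p = π(u)` iff `p ⊥ V` and `u - p ∈ V`. -/
def projLat {n : ℕ} (V : Submodule ℝ (Fin n → ℝ)) (x : AddSubgroup (Fin n → ℝ)) :
    AddSubgroup (Fin n → ℝ) where
  carrier := {p | (∀ v ∈ V, einner p v = 0) ∧ ∃ u ∈ x, u - p ∈ V}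
  zero_mem' := ⟨by intro v hv; simp [einner], 0, x.zero_mem, by rw [sub_zero]; exact V.zero_mem⟩
  add_mem' := by
    rintro p q ⟨hp1, u1, hu1, hp2⟩ ⟨hq1, u2, hu2, hq2⟩
    refine ⟨fun v hv => by rw [einner_add_left, hp1 v hv, hq1 v hv, add_zero],
      u1 + u2, x.add_mem hu1 hu2, ?_⟩
    have h : u1 + u2 - (p + q) = u1 - p + (u2 - q) := by abel
    rw [h]; exact V.add_mem hp2 hq2
  neg_mem' := by
    rintro p ⟨hp1, u, hu, hp2⟩
    refine ⟨fun v hv => by rw [einner_neg_left, hp1 v hv, neg_zero],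
      -u, x.neg_mem hu, ?_⟩
    have h : -u - -p = -(u - p) := by abel
    rw [h]; exact V.neg_mem hp2

end SW

namespace SW
section Gram

variable {E : Type*} [NormedAddCommGroup E] [InnerProductSpace ℝ E]
variable {ι κ μ : Type*} [Fintype ι] [DecidableEq ι] [Fintype κ] [DecidableEq κ]
  [Fintype μ] [DecidableEq μ]

lemma det_gram_comp_equiv (v : ι → E) (e : κ ≃ ι) :
    (gram ℝ (v ∘ e)).det = (gram ℝ v).det :=
  det_submatrix_equiv_self e (gram ℝ v)

lemma det_gram_sumElim_comp_equiv (v : ι → E) (w : κ → E) (e : μ ≃ κ) :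
    (gram ℝ (Sum.elim v (w ∘ e))).det = (gram ℝ (Sum.elim v w)).det := by
  rw [← det_gram_comp_equiv (Sum.elim v w) ((Equiv.refl ι).sumCongr e)]
  congr 2
  ext (i | i) <;> simp

lemma det_gram_of_eq_sum_smul {v w : ι → E} (P : Matrix ι ι ℝ)
    (h : ∀ i, w i = ∑ j, P i j • v j) :
    (gram ℝ w).det = P.det ^ 2 * (gram ℝ v).det := by
  have hw : gram ℝ w = P * gram ℝ v * Pᵀ := by
    ext i j
    simp only [gram_apply, h, mul_apply, transpose_apply, sum_inner, inner_sum,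
      real_inner_smul_left, real_inner_smul_right, Finset.sum_mul]
    exact Finset.sum_congr rfl fun _ _ => Finset.sum_congr rfl fun _ _ => by ring
  rw [hw, det_mul, det_mul, det_transpose]
  ring

lemma det_gram_sumElim_const (v : ι → E) {p q : E}
    (hp : p ∈ Submodule.span ℝ (Set.range v)) (hq : q ∈ (Submodule.span ℝ (Set.range v))ᗮ) :
    (gram ℝ (Sum.elim v fun _ : Unit => p + q)).det = (gram ℝ v).det * ‖q‖ ^ 2 := by
  obtain ⟨c, rfl⟩ := (Submodule.mem_span_range_iff_exists_fun ℝ).1 hp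
  have hvq : ∀ i, inner ℝ (v i) q = 0 := fun i =>
    hq (v i) (Submodule.subset_span (Set.mem_range_self i))
  have hqv : ∀ i, inner ℝ q (v i) = 0 := fun i => by rw [real_inner_comm, hvq]
  have hg : gram ℝ (Sum.elim v fun _ : Unit => q) =
      fromBlocks (gram ℝ v) 0 0 (of fun _ _ => ‖q‖ ^ 2) := by
    ext (i | i) (j | j) <;> simp [gram_apply, hvq, hqv]
  rw [det_gram_of_eq_sum_smul (v := Sum.elim v fun _ : Unit => q)
      (fromBlocks 1 0 (of fun _ i => c i) 1), hg, det_fromBlocks_zero₁₂, det_fromBlocks_zero₁₂]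
  · simp
  · rintro (i | i) <;> simp [one_apply, ite_smul]

lemma det_gram_nonneg (v : ι → E) : 0 ≤ (gram ℝ v).det :=
  (posSemidef_gram ℝ v).det_nonneg

lemma det_gram_pos {v : ι → E} (hv : LinearIndependent ℝ v) : 0 < (gram ℝ v).det :=
  (posDef_gram_of_linearIndependent hv).det_pos

lemma det_gram_sumElim_fin_succ {m : ℕ} (v : ι → E) (w : Fin (m + 1) → E) :
    (gram ℝ (Sum.elim v w)).det =
      (gram ℝ (Sum.elim (Sum.elim v fun i : Fin m => w i.castSucc)
        fun _ : Unit => w (Fin.last m))).det := by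
  let e : (ι ⊕ Fin m) ⊕ Unit ≃ ι ⊕ Fin (m + 1) :=
    (Equiv.sumAssoc _ _ _).trans ((Equiv.refl ι).sumCongr
      ((Equiv.optionEquivSumPUnit (Fin m)).symm.trans finSuccEquivLast.symm))
  rw [← det_gram_comp_equiv _ e]
  congr 2
  ext ((i | i) | i) <;> simp [e]

/-- The Koteljanskii inequality for Gram determinants. -/
lemma det_gram_mul_det_gram_le [FiniteDimensional ℝ E] (u : ι → E) (v : κ → E) (w : μ → E) :
    (gram ℝ (Sum.elim (Sum.elim u v) w)).det * (gram ℝ u).det ≤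
      (gram ℝ (Sum.elim u v)).det * (gram ℝ (Sum.elim u w)).det := by
  classical
  suffices H : ∀ (m : ℕ) (w : Fin m → E),
      (gram ℝ (Sum.elim (Sum.elim u v) w)).det * (gram ℝ u).det ≤
        (gram ℝ (Sum.elim u v)).det * (gram ℝ (Sum.elim u w)).det by
    let e := Fintype.equivFin μ
    have h := H _ (w ∘ e.symm)
    rwa [det_gram_sumElim_comp_equiv, det_gram_sumElim_comp_equiv] at h
  intro m
  induction m with
  | zero =>
    intro w
    rw [← det_gram_comp_equiv _ (Equiv.sumEmpty (ι ⊕ κ) (Fin 0)).symm,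
      ← det_gram_comp_equiv (Sum.elim u w) (Equiv.sumEmpty ι (Fin 0)).symm]
    exact le_rfl
  | succ m ih =>
    intro w
    set w' : Fin m → E := fun i => w i.castSucc with hw'
    set x := w (Fin.last m) with hx0
    obtain ⟨p, hp, q, hq, hx⟩ := Submodule.exists_add_mem_mem_orthogonal
      (K := Submodule.span ℝ (Set.range (Sum.elim u w'))) x
    obtain ⟨p', hp', q', hq', hx'⟩ := Submodule.exists_add_mem_mem_orthogonal
      (K := Submodule.span ℝ (Set.range (Sum.elim (Sum.elim u v) w'))) x
    have hsub : Submodule.span ℝ (Set.range (Sum.elim u w')) ≤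
        Submodule.span ℝ (Set.range (Sum.elim (Sum.elim u v) w')) := by
      refine Submodule.span_mono ?_
      simp only [Set.Sum.elim_range]
      exact Set.union_subset_union_left _ Set.subset_union_left
    have hle : ‖q'‖ ^ 2 ≤ ‖q‖ ^ 2 := by
      have hpq : q = (p' - p) + q' := by
        rw [sub_add_eq_add_sub, ← hx', hx, add_sub_cancel_left]
      have h0 : inner ℝ (p' - p) q' = 0 := hq' _ (Submodule.sub_mem _ hp' (hsub hp))
      rw [hpq, norm_add_sq_real, h0]
      nlinarith [sq_nonneg ‖p' - p‖]
    rw [det_gram_sumElim_fin_succ, det_gram_sumElim_fin_succ u, ← hw', ← hx0]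
    conv_lhs => rw [hx', det_gram_sumElim_const _ hp' hq']
    conv_rhs => rw [hx, det_gram_sumElim_const _ hp hq]
    calc _ = (gram ℝ (Sum.elim (Sum.elim u v) w')).det * (gram ℝ u).det * ‖q'‖ ^ 2 := by ring
      _ ≤ (gram ℝ (Sum.elim u v)).det * (gram ℝ (Sum.elim u w')).det * ‖q‖ ^ 2 :=
        mul_le_mul (ih w') hle (sq_nonneg _)
          (mul_nonneg (det_gram_nonneg _) (det_gram_nonneg _))
      _ = _ := by ring

end Gram

section Lattice

open Module

lemma linearIndependent_real_of_discrete {E ι : Type*} [NormedAddCommGroup E]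
    [NormedSpace ℝ E] [FiniteDimensional ℝ E] [Finite ι] {v : ι → E}
    (hd : DiscreteTopology (Submodule.span ℤ (Set.range v))) (hv : LinearIndependent ℤ v) :
    LinearIndependent ℝ v := by
  have := Fintype.ofFinite ι
  rw [linearIndependent_iff_card_eq_finrank_span] at hv ⊢
  rw [hv, Real.finrank_eq_int_finrank_of_discrete hd]

lemma discreteTopology_of_le {G : Type*} [AddGroup G] [TopologicalSpace G]
    {H K : AddSubgroup G} (h : H ≤ K) [DiscreteTopology K] : DiscreteTopology H :=
  DiscreteTopology.of_subset (s := (K : Set G)) ‹_› h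

variable {n : ℕ} {ι κ : Type*} [Fintype ι] [DecidableEq ι] [Fintype κ] [DecidableEq κ]

/-- The Gram determinant of a family of vectors for the Euclidean inner product. -/
def gramDet (v : ι → Fin n → ℝ) : ℝ :=
  (gram ℝ (WithLp.toLp 2 ∘ v)).det

lemma gvol_eq_sqrt_gramDet {r : ℕ} (v : Fin r → Fin n → ℝ) : gvol v = √(gramDet v) := by
  unfold gvol gramDet
  congr 2
  ext i j
  simp [einner, gram_apply, EuclideanSpace.inner_toLp_toLp, dotProduct, mul_comm]

lemma gramDet_nonneg (v : ι → Fin n → ℝ) : 0 ≤ gramDet v :=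
  det_gram_nonneg _

lemma gramDet_pos {v : ι → Fin n → ℝ} (hv : LinearIndependent ℝ v) : 0 < gramDet v :=
  det_gram_pos <|
    hv.map' (WithLp.linearEquiv 2 ℝ (Fin n → ℝ)).symm.toLinearMap (LinearEquiv.ker _)

lemma gramDet_comp_equiv (v : ι → Fin n → ℝ) (e : κ ≃ ι) : gramDet (v ∘ e) = gramDet v :=
  det_gram_comp_equiv (WithLp.toLp 2 ∘ v) e

lemma gramDet_mul_gramDet_le {μ : Type*} [Fintype μ] [DecidableEq μ]
    (u : ι → Fin n → ℝ) (v : κ → Fin n → ℝ) (w : μ → Fin n → ℝ) :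
    gramDet (Sum.elim (Sum.elim u v) w) * gramDet u ≤
      gramDet (Sum.elim u v) * gramDet (Sum.elim u w) := by
  simp only [gramDet, Sum.comp_elim]
  exact det_gram_mul_det_gram_le _ _ _

lemma gramDet_eq_relIndex_sq_mul {L₁ L₂ : AddSubgroup (Fin n → ℝ)} (h : L₁ ≤ L₂)
    (b₁ : Basis ι ℤ L₁.toIntSubmodule) (b₂ : Basis ι ℤ L₂.toIntSubmodule) :
    gramDet (fun i => (b₁ i : Fin n → ℝ)) =
      (L₁.relIndex L₂ : ℝ) ^ 2 * gramDet fun i => (b₂ i : Fin n → ℝ) := by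
  set c : ι → L₂.toIntSubmodule := fun i => ⟨b₁ i, h (SetLike.coe_mem _)⟩ with hc
  have hsum : ∀ i, (b₁ i : Fin n → ℝ) = ∑ j, ((b₂.toMatrix c j i : ℤ) : ℝ) • (b₂ j : Fin n → ℝ) := by
    intro i
    have := congrArg Subtype.val (b₂.sum_repr (c i))
    simp only [AddSubmonoidClass.coe_finsetSum, SetLike.val_smul] at this
    simp only [Basis.toMatrix_apply, Int.cast_smul_eq_zsmul]
    exact this.symm
  have hdet := AddSubgroup.relIndex_eq_natAbs_det L₁ L₂ h b₁ b₂
  rw [← hc, Basis.det_apply] at hdet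
  unfold gramDet
  rw [det_gram_of_eq_sum_smul (v := WithLp.toLp 2 ∘ fun i => (b₂ i : Fin n → ℝ))
    (((b₂.toMatrix c).map (Int.cast : ℤ → ℝ))ᵀ)]
  · rw [hdet, det_transpose, ← Int.cast_det, Nat.cast_natAbs, Int.cast_abs, sq_abs]
  · intro i
    exact (congrArg (WithLp.toLp 2) (hsum i)).trans (by simp [WithLp.toLp_sum])

lemma exists_basis_coe_eq {α : Type*} {v : α → Fin n → ℝ} (hv : LinearIndependent ℝ v) :
    ∃ b : Basis α ℤ (AddSubgroup.closure (Set.range v)).toIntSubmodule,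
      ∀ i, (b i : Fin n → ℝ) = v i :=
  ⟨(Basis.span (hv.restrict_scalars' ℤ)).map
    (LinearEquiv.ofEq _ _ (AddSubgroup.toIntSubmodule_closure _).symm),
    fun i => by simp [Basis.span_apply]⟩

lemma gramDet_closure_eq {v w : ι → Fin n → ℝ} (hv : LinearIndependent ℝ v)
    (hw : LinearIndependent ℝ w)
    (h : AddSubgroup.closure (Set.range v) ≤ AddSubgroup.closure (Set.range w)) :
    gramDet v = ((AddSubgroup.closure (Set.range v)).relIndex
      (AddSubgroup.closure (Set.range w)) : ℝ) ^ 2 * gramDet w := by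
  obtain ⟨b, hb⟩ := exists_basis_coe_eq hv
  obtain ⟨c, hc⟩ := exists_basis_coe_eq hw
  simpa only [hb, hc] using gramDet_eq_relIndex_sq_mul h b c

lemma exists_linearIndependent_closure_eq (L : AddSubgroup (Fin n → ℝ)) [DiscreteTopology L] :
    ∃ (r : ℕ) (v : Fin r → Fin n → ℝ), LinearIndependent ℝ v ∧
      L = AddSubgroup.closure (Set.range v) := by
  have : DiscreteTopology L.toIntSubmodule := ‹DiscreteTopology L›
  let b := Module.finBasis ℤ L.toIntSubmodule
  have hspan : Submodule.span ℤ (Set.range fun i => (b i : Fin n → ℝ)) = L.toIntSubmodule := by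
    have := congrArg (Submodule.map L.toIntSubmodule.subtype) b.span_eq
    rw [Submodule.map_span, ← Set.range_comp] at this
    simpa [Function.comp_def] using this
  refine ⟨_, fun i => b i, ?_, ?_⟩
  · refine linearIndependent_real_of_discrete (by rwa [hspan]) ?_
    exact b.linearIndependent.map' L.toIntSubmodule.subtype (Submodule.ker_subtype _)
  · apply AddSubgroup.toIntSubmodule.injective
    rw [AddSubgroup.toIntSubmodule_closure, hspan]

lemma span_real_closure (s : Set (Fin n → ℝ)) :
    Submodule.span ℝ (AddSubgroup.closure s : Set (Fin n → ℝ)) = Submodule.span ℝ s := by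
  refine le_antisymm (Submodule.span_le.2 ?_) (Submodule.span_mono AddSubgroup.subset_closure)
  exact (AddSubgroup.closure_le (K := (Submodule.span ℝ s).toAddSubgroup)).2 Submodule.subset_span

/-- A maximal real-independent family in a discrete subgroup computes its covolume up to the
index of the subgroup it generates. -/
lemma relIndex_mul_covol (L : AddSubgroup (Fin n → ℝ)) [DiscreteTopology L]
    {v : ι → Fin n → ℝ} (hv : LinearIndependent ℝ v) (hvL : ∀ i, v i ∈ L)
    (hLv : (L : Set (Fin n → ℝ)) ⊆ Submodule.span ℝ (Set.range v)) :
    ((AddSubgroup.closure (Set.range v)).relIndex L : ℝ) * covol L = √(gramDet v) := by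
  set m : ℝ := ((AddSubgroup.closure (Set.range v)).relIndex L : ℝ) with hm
  have hle : AddSubgroup.closure (Set.range v) ≤ L :=
    (AddSubgroup.closure_le _).2 (Set.range_subset_iff.2 hvL)
  have hspan : Submodule.span ℝ (Set.range v) = Submodule.span ℝ (L : Set (Fin n → ℝ)) :=
    le_antisymm (Submodule.span_mono (Set.range_subset_iff.2 hvL)) (Submodule.span_le.2 hLv)
  have key : ∀ c, covolSpec L c → m * c = √(gramDet v) := by
    rintro c ⟨r, w, hw, rfl, rfl⟩
    rw [span_real_closure] at hspan
    have hcard : Fintype.card ι = Fintype.card (Fin r) := by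
      rw [← finrank_span_eq_card hv, ← finrank_span_eq_card hw, hspan]
    let e := Fintype.equivOfCardEq hcard
    have hrange : Set.range (w ∘ e) = Set.range w := e.surjective.range_comp w
    have h := gramDet_closure_eq hv (hw.comp e e.injective) (by rwa [hrange])
    rw [hrange, ← hm, gramDet_comp_equiv] at h
    rw [gvol_eq_sqrt_gramDet, h, Real.sqrt_mul (sq_nonneg _), Real.sqrt_sq (Nat.cast_nonneg _)]
  have hm0 : m ≠ 0 := by
    obtain ⟨r, w, hw, hL⟩ := exists_linearIndependent_closure_eq L
    intro h0
    have := key _ ⟨r, w, hw, hL, rfl⟩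
    rw [h0, zero_mul] at this
    exact (Real.sqrt_pos.2 (gramDet_pos hv)).ne this
  obtain ⟨r, w, hw, hL⟩ := exists_linearIndependent_closure_eq L
  have hset : {c | covolSpec L c} = {gvol w} := by
    refine Set.eq_singleton_iff_unique_mem.2 ⟨⟨r, w, hw, hL, rfl⟩, fun c hc => ?_⟩
    exact mul_left_cancel₀ hm0 ((key c hc).trans (key _ ⟨r, w, hw, hL, rfl⟩).symm)
  rw [covol, hset, csInf_singleton]
  exact key _ ⟨r, w, hw, hL, rfl⟩

lemma exists_sumElim_linearIndependent {K E : Type*} [Field K] [AddCommGroup E] [Module K E]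
    [FiniteDimensional K E] {ι : Type*} {u : ι → E} (hu : LinearIndependent K u) {s : Set E}
    (hs : ∀ i, u i ∈ s) :
    ∃ (r : ℕ) (v : Fin r → E), (∀ i, v i ∈ s) ∧ LinearIndependent K (Sum.elim u v) ∧
      s ⊆ Submodule.span K (Set.range (Sum.elim u v)) := by
  obtain ⟨B, huB, hBs, hsB, hB⟩ : ∃ B, Set.range u ⊆ B ∧ B ⊆ s ∧
      s ⊆ Submodule.span K B ∧ LinearIndepOn K id B :=
    have hsub := Set.range_subset_iff.2 hs
    have hu' := hu.linearIndepOn_id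
    ⟨hu'.extend hsub, hu'.subset_extend hsub, hu'.extend_subset hsub,
      hu'.subset_span_extend hsub, hu'.linearIndepOn_extend hsub⟩
  have hBfin : B.Finite := hB.linearIndependent.setFinite
  have := (hBfin.subset (Set.sdiff_subset (s := B) (t := Set.range u))).fintype
  let e := (Fintype.equivFin ↥(B \ Set.range u)).symm
  have hrange : Set.range (fun i => (e i : E)) = B \ Set.range u :=
    (e.surjective.range_comp Subtype.val).trans Subtype.range_coe
  have hunion : Set.range u ∪ B \ Set.range u = B := Set.union_sdiff_cancel huB
  rw [← hunion, linearIndepOn_id_union_iff Set.disjoint_sdiff_right] at hB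
  refine ⟨_, fun i => (e i : E), fun i => hBs (e i).2.1, ?_, ?_⟩
  · refine hu.sum_type (hB.2.1.linearIndependent.comp e e.injective) ?_
    rw [hrange]
    exact hB.2.2
  · rwa [Set.Sum.elim_range, hrange, hunion]

lemma relIndex_sup_sup {G : Type*} [AddCommGroup G] {A B H K : AddSubgroup G}
    (hA : A ≤ H) (hB : B ≤ K) (hHA : H ⊓ K ≤ A) (hHB : H ⊓ K ≤ B) :
    (A ⊔ B).relIndex (H ⊔ K) = A.relIndex H * B.relIndex K := by
  have h1 : (A ⊔ B).relIndex (H ⊔ B) = A.relIndex H := by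
    have : H ⊔ B = H ⊔ (A ⊔ B) := by rw [← sup_assoc, sup_eq_left.2 hA]
    rw [this, AddSubgroup.relIndex_sup_right, ← AddSubgroup.inf_relIndex_right,
      sup_inf_assoc_of_le _ hA, sup_eq_left.2 (le_trans (by rw [inf_comm]; gcongr) hHA)]
  have h2 : (H ⊔ B).relIndex (H ⊔ K) = B.relIndex K := by
    have : H ⊔ K = K ⊔ (H ⊔ B) := by
      rw [sup_comm H B, ← sup_assoc, sup_eq_left.2 hB, sup_comm]
    rw [this, AddSubgroup.relIndex_sup_right, ← AddSubgroup.inf_relIndex_right,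
      sup_comm H B, sup_inf_assoc_of_le _ hB, sup_eq_left.2 hHB]
  rw [← AddSubgroup.relIndex_mul_relIndex _ _ _ (sup_le_sup_right hA B) (sup_le_sup_left hB H),
    h1, h2]

lemma linearIndependent_sumElim_of_inf_eq {α β γ : Type*} [Finite α] [Finite β] [Finite γ]
    {L L' : AddSubgroup (Fin n → ℝ)} [DiscreteTopology ↥(L ⊔ L')]
    {u : α → Fin n → ℝ} {v : β → Fin n → ℝ} {w : γ → Fin n → ℝ}
    (hu : L ⊓ L' = AddSubgroup.closure (Set.range u))
    (huv : LinearIndependent ℝ (Sum.elim u v)) (huw : LinearIndependent ℝ (Sum.elim u w))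
    (hv : ∀ i, v i ∈ L) (hw : ∀ i, w i ∈ L') :
    LinearIndependent ℝ (Sum.elim (Sum.elim u v) w) := by
  have huL : ∀ i, u i ∈ L ⊓ L' := fun i => by
    rw [hu]; exact AddSubgroup.subset_closure (Set.mem_range_self i)
  have huvL : Submodule.span ℤ (Set.range (Sum.elim u v)) ≤ L.toIntSubmodule := by
    rw [Submodule.span_le, Set.range_subset_iff]
    rintro (i | i)
    exacts [(huL i).1, hv i]
  have hwL : Submodule.span ℤ (Set.range w) ≤ L'.toIntSubmodule :=
    Submodule.span_le.2 (Set.range_subset_iff.2 hw)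
  have hdisj := (linearIndependent_sum.1 (huw.restrict_scalars' ℤ)).2.2
  simp only [Sum.elim_comp_inl, Sum.elim_comp_inr] at hdisj
  have hind : LinearIndependent ℤ (Sum.elim (Sum.elim u v) w) := by
    refine (huv.restrict_scalars' ℤ).sum_type
      ((huw.comp _ Sum.inr_injective).restrict_scalars' ℤ) ?_
    rw [Submodule.disjoint_def] at hdisj ⊢
    refine fun x hx hx' => hdisj x ?_ hx'
    have hxL : x ∈ (L ⊓ L').toIntSubmodule := ⟨huvL hx, hwL hx'⟩
    rwa [hu, AddSubgroup.toIntSubmodule_closure] at hxL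
  refine linearIndependent_real_of_discrete ?_ hind
  refine DiscreteTopology.of_subset (s := ((L ⊔ L' : AddSubgroup _) : Set (Fin n → ℝ))) ‹_› ?_
  have : Submodule.span ℤ (Set.range (Sum.elim (Sum.elim u v) w)) ≤
      (L ⊔ L').toIntSubmodule := by
    rw [Set.Sum.elim_range, Submodule.span_union]
    exact sup_le (fun x hx => (le_sup_left : L ≤ L ⊔ L') (huvL hx))
      (fun x hx => (le_sup_right : L' ≤ L ⊔ L') (hwL hx))
  exact this

end Lattice

end SW

/-- **Inequality (2.11).** For discrete subgroups `Λ, Λ'` of `ℝⁿ` with `Λ + Λ'` discrete,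
`|Λ + Λ'| ≤ |Λ|·|Λ'| / |Λ ∩ Λ'|`. -/
theorem SW.covol_sup_le (n : ℕ) (Λ Λ' : AddSubgroup (Fin n → ℝ))
    (h1 : DiscreteTopology ↥Λ) (h2 : DiscreteTopology ↥Λ')
    (h3 : DiscreteTopology ↥(Λ ⊔ Λ')) :
    SW.covol (Λ ⊔ Λ') ≤ SW.covol Λ * SW.covol Λ' / SW.covol (Λ ⊓ Λ') := by
  have h0 : DiscreteTopology ↥(Λ ⊓ Λ') := SW.discreteTopology_of_le (inf_le_left : _ ≤ Λ)
  obtain ⟨k, u, hu, huΛ⟩ := SW.exists_linearIndependent_closure_eq (Λ ⊓ Λ')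
  have hmem : ∀ i, u i ∈ Λ ⊓ Λ' := fun i => by
    rw [huΛ]; exact AddSubgroup.subset_closure (Set.mem_range_self i)
  obtain ⟨p, v, hv, huv, hΛ⟩ :=
    SW.exists_sumElim_linearIndependent hu (s := (Λ : Set (Fin n → ℝ))) fun i => (hmem i).1
  obtain ⟨q, w, hw, huw, hΛ'⟩ :=
    SW.exists_sumElim_linearIndependent hu (s := (Λ' : Set (Fin n → ℝ))) fun i => (hmem i).2
  have huvw := SW.linearIndependent_sumElim_of_inf_eq huΛ huv huw hv hw
  have hmemv : ∀ i, Sum.elim u v i ∈ Λ := Sum.rec (fun i => (hmem i).1) hv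
  have hmemw : ∀ i, Sum.elim u w i ∈ Λ' := Sum.rec (fun i => (hmem i).2) hw
  have hmemvw : ∀ i, Sum.elim (Sum.elim u v) w i ∈ Λ ⊔ Λ' :=
    Sum.rec (fun i => AddSubgroup.mem_sup_left (hmemv i))
      fun i => AddSubgroup.mem_sup_right (hw i)
  have hspan : ((Λ ⊔ Λ' : AddSubgroup _) : Set (Fin n → ℝ)) ⊆
      Submodule.span ℝ (Set.range (Sum.elim (Sum.elim u v) w)) := by
    refine (sup_le (c := (Submodule.span ℝ
      (Set.range (Sum.elim (Sum.elim u v) w))).toAddSubgroup) ?_ ?_ :)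
    · refine fun x hx => Submodule.span_mono ?_ (hΛ hx)
      simp only [Set.Sum.elim_range]
      exact Set.subset_union_left
    · refine fun x hx => Submodule.span_mono ?_ (hΛ' hx)
      simp only [Set.Sum.elim_range]
      exact Set.union_subset_union_left _ Set.subset_union_left
  have hclosure : AddSubgroup.closure (Set.range (Sum.elim (Sum.elim u v) w)) =
      AddSubgroup.closure (Set.range (Sum.elim u v)) ⊔
        AddSubgroup.closure (Set.range (Sum.elim u w)) := by
    simp only [Set.Sum.elim_range, AddSubgroup.closure_union, sup_sup_sup_comm, sup_idem]
    rw [sup_assoc]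
  have hidx := SW.relIndex_sup_sup
    ((AddSubgroup.closure_le Λ).2 (Set.range_subset_iff.2 hmemv))
    ((AddSubgroup.closure_le Λ').2 (Set.range_subset_iff.2 hmemw))
    (huΛ.trans_le (AddSubgroup.closure_mono (by simp [Set.Sum.elim_range])))
    (huΛ.trans_le (AddSubgroup.closure_mono (by simp [Set.Sum.elim_range])))
  rw [← hclosure] at hidx
  have eu := SW.relIndex_mul_covol (Λ ⊓ Λ') hu hmem
    (by rw [huΛ, ← SW.span_real_closure]; exact Submodule.subset_span)
  have ev := SW.relIndex_mul_covol Λ huv hmemv hΛ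
  have ew := SW.relIndex_mul_covol Λ' huw hmemw hΛ'
  have evw := SW.relIndex_mul_covol (Λ ⊔ Λ') huvw hmemvw hspan
  rw [← huΛ, AddSubgroup.relIndex_self, Nat.cast_one, one_mul] at eu
  have hupos : 0 < SW.covol (Λ ⊓ Λ') := eu ▸ Real.sqrt_pos.2 (SW.gramDet_pos hu)
  have hvwpos := Real.sqrt_pos.2 (SW.gramDet_pos huvw)
  rw [← evw] at hvwpos
  have hle := Real.sqrt_le_sqrt (SW.gramDet_mul_gramDet_le u v w)
  rw [Real.sqrt_mul (SW.gramDet_nonneg _), Real.sqrt_mul (SW.gramDet_nonneg _),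
    ← evw, ← eu, ← ev, ← ew, hidx, Nat.cast_mul] at hle
  rw [hidx, Nat.cast_mul] at hvwpos
  rw [le_div_iff₀ hupos]
  refine le_of_mul_le_mul_left ?_
    (lt_of_le_of_ne (by positivity) (left_ne_zero_of_mul hvwpos.ne').symm)
  linarith
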